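/- arXiv:2205.04543 — 3 statements merged into one kernel-verified Lean document; each statement's English description precedes it below -/
import Mathlib

section
/- Let X be a non-empty set and (E, ‖·‖_E) a normed space. For a non-empty subset A of B(X,E) the following are equivalent: (i) A satisfies the condition (DS) and for every x ∈ X the section A(x) is precompact; (ii) A − A satisfies the condition (B) and the set A(X) := ⋃_{x∈X} A(x) is precompact. -/
open Pointwise

/-- Condition (B) for a set of (bounded) functions. -/
def CondB {X E : Type*} [TopologicalSpace X] [NormedAddCommGroup E]
    (S : Set (BoundedContinuousFunction X E)) : Prop :=
  ∀ ε : ℝ, 0 < ε → ∃ (N : ℕ) (U : Fin N → Set X),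
    (⋃ i, U i) = Set.univ ∧
    ∀ i : Fin N, ∀ x ∈ U i, ∀ y ∈ U i, ∀ f ∈ S, |‖f x‖ - ‖f y‖| ≤ ε

/-- Condition (DS): for every `ε > 0` there are finitely many non-empty subsets
`U_1, …, U_N` of `X` whose union is `X` such that `‖f x - f y‖ ≤ ε` for all `x, y` in
the same `U_i` and all `f` in the set. -/
def CondDS {X E : Type*} [TopologicalSpace X] [NormedAddCommGroup E]
    (S : Set (BoundedContinuousFunction X E)) : Prop :=
  ∀ ε : ℝ, 0 < ε → ∃ (N : ℕ) (U : Fin N → Set X),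
    (∀ i, (U i).Nonempty) ∧ (⋃ i, U i) = Set.univ ∧
    ∀ i : Fin N, ∀ x ∈ U i, ∀ y ∈ U i, ∀ f ∈ S, ‖f x - f y‖ ≤ ε

theorem totallyBounded_pi {ι : Type*} {Y : ι → Type*} [∀ i, UniformSpace (Y i)]
    {s : ∀ i, Set (Y i)} (hs : ∀ i, TotallyBounded (s i)) :
    TotallyBounded (Set.pi Set.univ s) := by
  refine totallyBounded_iff_ultrafilter.2 fun l hl => (cauchy_pi_iff' Y).2 fun i => ?_
  refine totallyBounded_iff_ultrafilter.1 (hs i) (l.map (Function.eval i)) ?_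
  refine (Filter.map_mono hl).trans ?_
  rw [Filter.map_principal, Filter.principal_mono]
  rintro _ ⟨z, hz, rfl⟩
  exact hz i trivial

/-- A map with totally bounded range admits finite covers by non-empty sets on which it varies
by at most `ε`. -/
theorem exists_finite_cover_dist_le {Z Y : Type*} [PseudoMetricSpace Y] (φ : Z → Y)
    (h : TotallyBounded (Set.range φ)) {ε : ℝ} (hε : 0 < ε) :
    ∃ (N : ℕ) (U : Fin N → Set Z), (∀ i, (U i).Nonempty) ∧ (⋃ i, U i) = Set.univ ∧
      ∀ i : Fin N, ∀ x ∈ U i, ∀ y ∈ U i, dist (φ x) (φ y) ≤ ε := by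
  obtain ⟨t, ht, hcov⟩ := Metric.totallyBounded_iff.1 h (ε / 2) (half_pos hε)
  let s := {c ∈ t | (φ ⁻¹' Metric.ball c (ε / 2)).Nonempty}
  have hs : s.Finite := ht.subset (Set.sep_subset _ _)
  obtain ⟨N, e, -, he⟩ := hs.fin_param
  refine ⟨N, fun i => φ ⁻¹' Metric.ball (e i) (ε / 2), fun i => ?_, ?_, fun i x hx y hy => ?_⟩
  · have hi : e i ∈ s := he ▸ Set.mem_range_self i
    exact hi.2
  · refine Set.eq_univ_of_forall fun z => ?_
    obtain ⟨c, hc, hz⟩ := Set.mem_iUnion₂.1 (hcov (Set.mem_range_self z))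
    have hcs : c ∈ s := ⟨hc, z, hz⟩
    obtain ⟨i, rfl⟩ : c ∈ Set.range e := he ▸ hcs
    exact Set.mem_iUnion.2 ⟨i, hz⟩
  · have h1 := Metric.mem_ball.1 hx
    have h2 := Metric.mem_ball.1 hy
    linarith [dist_triangle_right (φ x) (φ y) (e i)]

theorem CondDS.condB_sub {X E : Type*} [TopologicalSpace X] [NormedAddCommGroup E]
    {A : Set (BoundedContinuousFunction X E)} (h : CondDS A) : CondB (A - A) := by
  intro ε hε
  obtain ⟨N, U, -, hcov, hU⟩ := h (ε / 2) (half_pos hε)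
  refine ⟨N, U, hcov, fun i x hx y hy k hk => ?_⟩
  obtain ⟨f, hf, g, hg, rfl⟩ := Set.mem_sub.1 hk
  have hfg : (f - g) x - (f - g) y = (f x - f y) - (g x - g y) := by
    simp only [BoundedContinuousFunction.sub_apply]; abel
  calc |‖(f - g) x‖ - ‖(f - g) y‖| ≤ ‖(f - g) x - (f - g) y‖ := abs_norm_sub_norm_le _ _
    _ ≤ ‖f x - f y‖ + ‖g x - g y‖ := hfg ▸ norm_sub_le _ _
    _ ≤ ε := by linarith [hU i x hx y hy f hf, hU i x hx y hy g hg]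

theorem CondDS.totallyBounded_iUnion {X E : Type*} [TopologicalSpace X] [NormedAddCommGroup E]
    {A : Set (BoundedContinuousFunction X E)} (h : CondDS A)
    (hA : ∀ x : X, TotallyBounded ((fun f : BoundedContinuousFunction X E => f x) '' A)) :
    TotallyBounded (⋃ x : X, (fun f : BoundedContinuousFunction X E => f x) '' A) := by
  refine Metric.totallyBounded_iff.2 fun ε hε => ?_
  obtain ⟨N, U, hne, hcov, hU⟩ := h (ε / 2) (half_pos hε)
  choose p hp using hne
  choose t ht htcov using fun i => Metric.totallyBounded_iff.1 (hA (p i)) (ε / 2) (half_pos hε)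
  refine ⟨⋃ i, t i, Set.finite_iUnion ht, ?_⟩
  rintro _ ⟨_, ⟨x, rfl⟩, f, hf, rfl⟩
  obtain ⟨i, hx⟩ := Set.mem_iUnion.1 (hcov ▸ Set.mem_univ x)
  obtain ⟨c, hc, hfc⟩ := Set.mem_iUnion₂.1 (htcov i ⟨f, hf, rfl⟩)
  refine Set.mem_iUnion₂.2 ⟨c, Set.mem_iUnion.2 ⟨i, hc⟩, Metric.mem_ball.2 ?_⟩
  have hfx : dist (f x) (f (p i)) ≤ ε / 2 := by
    rw [dist_eq_norm]; exact hU i x hx (p i) (hp i) f hf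
  have hfc' : dist (f (p i)) c < ε / 2 := hfc
  exact (dist_triangle _ (f (p i)) _).trans_lt (by linarith)

theorem CondB.exists_finite_cover_of_sub {X E : Type*} [Nonempty X] [TopologicalSpace X]
    [NormedAddCommGroup E] {A : Set (BoundedContinuousFunction X E)} (h : CondB (A - A))
    (hA : TotallyBounded (⋃ x : X, (fun f : BoundedContinuousFunction X E => f x) '' A))
    {ε : ℝ} (hε : 0 < ε) :
    ∃ (M : ℕ) (V : Fin M → Set A), (∀ j, (V j).Nonempty) ∧ (⋃ j, V j) = Set.univ ∧
      ∀ j, ∀ f ∈ V j, ∀ g ∈ V j, ∀ x, ‖f.1 x - g.1 x‖ ≤ ε := by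
  obtain ⟨N, U, hcov, hU⟩ := h (ε / 2) (half_pos hε)
  have hp : ∀ i, ∃ p, (U i).Nonempty → p ∈ U i := fun i => by
    by_cases hi : (U i).Nonempty
    · exact ⟨hi.some, fun _ => hi.some_mem⟩
    · exact ⟨Classical.arbitrary X, fun h' => absurd h' hi⟩
  choose p hp using hp
  have hrange : TotallyBounded (Set.range fun (f : A) (i : Fin N) => f.1 (p i)) := by
    refine (totallyBounded_pi fun _ => hA).subset ?_
    rintro _ ⟨f, rfl⟩ i -
    exact Set.mem_iUnion.2 ⟨p i, f.1, f.2, rfl⟩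
  obtain ⟨M, V, hne, hVcov, hV⟩ := exists_finite_cover_dist_le _ hrange (half_pos hε)
  refine ⟨M, V, hne, hVcov, fun j f hf g hg x => ?_⟩
  obtain ⟨i, hx⟩ := Set.mem_iUnion.1 (hcov ▸ Set.mem_univ x)
  have h1 := (abs_le.1 (hU i x hx (p i) (hp i ⟨x, hx⟩) _ (Set.sub_mem_sub f.2 g.2))).2
  have h2 := (dist_le_pi_dist _ _ i).trans (hV j f hf g hg)
  simp only [BoundedContinuousFunction.sub_apply] at h1
  rw [dist_eq_norm] at h2
  linarith

theorem CondB.condDS_of_sub {X E : Type*} [Nonempty X] [TopologicalSpace X]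
    [NormedAddCommGroup E] {A : Set (BoundedContinuousFunction X E)} (h : CondB (A - A))
    (hA : TotallyBounded (⋃ x : X, (fun f : BoundedContinuousFunction X E => f x) '' A)) :
    CondDS A := by
  intro ε hε
  have hε3 : 0 < ε / 3 := by positivity
  obtain ⟨M, V, hne, hVcov, hV⟩ := h.exists_finite_cover_of_sub hA hε3
  choose g hg using hne
  have hrange : TotallyBounded (Set.range fun (x : X) (j : Fin M) => (g j).1 x) := by
    refine (totallyBounded_pi fun _ => hA).subset ?_
    rintro _ ⟨x, rfl⟩ j -
    exact Set.mem_iUnion.2 ⟨x, (g j).1, (g j).2, rfl⟩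
  obtain ⟨N, W, hWne, hWcov, hW⟩ := exists_finite_cover_dist_le _ hrange hε3
  refine ⟨N, W, hWne, hWcov, fun i x hx y hy f hf => ?_⟩
  obtain ⟨j, hfj⟩ := Set.mem_iUnion.1 (hVcov ▸ Set.mem_univ (⟨f, hf⟩ : A))
  have h1 := hV j _ hfj _ (hg j) x
  have h2 := (dist_le_pi_dist _ _ j).trans (hW i x hx y hy)
  have h3 := hV j _ (hg j) _ hfj y
  rw [← dist_eq_norm] at h1 h3 ⊢
  linarith [dist_triangle4 (f x) ((g j).1 x) ((g j).1 y) (f y)]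

/-- For a non-empty `A ⊆ B(X,E)` (with `X` a non-empty set, i.e. a discrete space) the
following are equivalent: (i) `A` satisfies (DS) and all sections `A(x)` are precompact;
(ii) `A - A` satisfies (B) and `A(X)` is precompact. -/
theorem stmt_4 {X E : Type*} [Nonempty X] [TopologicalSpace X] [DiscreteTopology X]
    [NormedAddCommGroup E] [NormedSpace ℝ E]
    (A : Set (BoundedContinuousFunction X E)) (hA : A.Nonempty) :
    (CondDS A ∧
        ∀ x : X, TotallyBounded ((fun f : BoundedContinuousFunction X E => f x) '' A)) ↔
      (CondB (A - A) ∧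
        TotallyBounded (⋃ x : X, (fun f : BoundedContinuousFunction X E => f x) '' A)) := by
  exact
  ⟨fun ⟨h, hsec⟩ => ⟨h.condB_sub, h.totallyBounded_iUnion hsec⟩,
    fun ⟨h, htb⟩ => ⟨h.condDS_of_sub htb, fun x =>
      htb.subset (Set.subset_iUnion
        (fun x => (fun f : BoundedContinuousFunction X E => f x) '' A) x)⟩⟩
end

section
/- Let X be a topological space and (E, ‖·‖_E) a normed space. A non-empty subset A of C(X,E), the space of bounded continuous maps X → E with the supremum norm, is precompact if and only if the algebraic difference A − A satisfies the condition (B) and for every x ∈ X the section A(x) is precompact in E. -/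
open Pointwise

open Filter Set Uniformity

theorem TotallyBounded.prod_set {α β : Type*} [UniformSpace α] [UniformSpace β]
    {s : Set α} {t : Set β} (hs : TotallyBounded s) (ht : TotallyBounded t) :
    TotallyBounded (s ×ˢ t) := by
  rw [totallyBounded_iff_ultrafilter] at *
  intro F hF
  rw [le_principal_iff] at hF
  refine cauchy_prod_iff.2 ⟨hs (F.map Prod.fst) ?_, ht (F.map Prod.snd) ?_⟩
  · exact tendsto_principal.2 (mem_of_superset hF fun p hp => hp.1)
  · exact tendsto_principal.2 (mem_of_superset hF fun p hp => hp.2)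

theorem TotallyBounded.sub_set {G : Type*} [UniformSpace G] [AddGroup G] [IsUniformAddGroup G]
    {s t : Set G} (hs : TotallyBounded s) (ht : TotallyBounded t) : TotallyBounded (s - t) := by
  rw [← sub_image_prod]
  exact (hs.prod_set ht).image uniformContinuous_sub

theorem TotallyBounded.condB {X E : Type*} [TopologicalSpace X] [NormedAddCommGroup E]
    {S : Set (BoundedContinuousFunction X E)} (hS : TotallyBounded S) : CondB S := by
  intro ε hε
  obtain ⟨t, ht, hSt⟩ := Metric.totallyBounded_iff.1 hS (ε / 4) (by positivity)
  have := ht.to_subtype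
  have := Fintype.ofFinite t
  let φ : X → t → ℝ := fun x f => ‖f.1 x‖
  have hφ : TotallyBounded (range φ) := by
    refine (isCompact_univ_pi fun f : t =>
      isCompact_Icc (a := (0 : ℝ)) (b := ‖f.1‖)).totallyBounded.subset ?_
    rintro _ ⟨x, rfl⟩ f -
    exact ⟨norm_nonneg _, f.1.norm_coe_le_norm x⟩
  obtain ⟨u, hu, hφu⟩ := Metric.totallyBounded_iff.1 hφ (ε / 4) (by positivity)
  have := hu.to_subtype
  let e := Finite.equivFin u
  refine ⟨Nat.card u, fun i => φ ⁻¹' Metric.ball (e.symm i).1 (ε / 4), ?_, ?_⟩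
  · refine eq_univ_of_forall fun x => ?_
    obtain ⟨y, hy, hxy⟩ := mem_iUnion₂.1 (hφu (mem_range_self x))
    exact mem_iUnion.2 ⟨e ⟨y, hy⟩, by rwa [mem_preimage, e.symm_apply_apply]⟩
  · intro i x hx y hy f hf
    obtain ⟨g, hg, hfg⟩ := mem_iUnion₂.1 (hSt hf)
    have hxy : dist (φ x) (φ y) < ε / 4 + ε / 4 :=
      (dist_triangle_right _ _ _).trans_lt (add_lt_add hx hy)
    have hgxy : |‖g x‖ - ‖g y‖| < ε / 4 + ε / 4 :=
      (dist_le_pi_dist (φ x) (φ y) ⟨g, hg⟩).trans_lt hxy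
    have close (z : X) : |‖f z‖ - ‖g z‖| < ε / 4 :=
      (abs_norm_sub_norm_le _ _).trans_lt <| by
        rw [← dist_eq_norm]
        exact (BoundedContinuousFunction.dist_coe_le_dist z).trans_lt hfg
    have hx := abs_lt.1 (close x)
    have hy := abs_lt.1 (close y)
    rw [abs_lt] at hgxy
    exact abs_le.2 ⟨by linarith, by linarith⟩

theorem CondB.totallyBounded {X E : Type*} [TopologicalSpace X] [NormedAddCommGroup E]
    {A : Set (BoundedContinuousFunction X E)} (hB : CondB (A - A))
    (hA : ∀ x : X, TotallyBounded ((fun f : BoundedContinuousFunction X E => f x) '' A)) :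
    TotallyBounded A := by
  rw [totallyBounded_iff_ultrafilter]
  intro F hF
  rw [le_principal_iff] at hF
  refine ⟨F.neBot, Metric.uniformity_basis_dist_le.ge_iff.2 fun ε hε => ?_⟩
  obtain ⟨N, U, hU, hUB⟩ := hB (ε / 2) (by positivity)
  have near (x : X) : ∀ᶠ p in (F : Filter (BoundedContinuousFunction X E)) ×ˢ F,
      dist (p.1 x) (p.2 x) < ε / 2 := by
    have hc := totallyBounded_iff_ultrafilter.1 (hA x) (F.map fun f => f x)
      (tendsto_principal.2 (mem_of_superset hF fun f hf => mem_image_of_mem _ hf))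
    have h := hc.2 (Metric.dist_mem_uniformity (half_pos hε))
    rwa [Ultrafilter.coe_map, prod_map_map_eq] at h
  have near_U : ∀ᶠ p in (F : Filter (BoundedContinuousFunction X E)) ×ˢ F,
      ∀ i, ∀ hi : (U i).Nonempty, dist (p.1 hi.some) (p.2 hi.some) < ε / 2 :=
    eventually_all.2 fun i => eventually_all.2 fun hi => near hi.some
  filter_upwards [near_U, prod_mem_prod hF hF] with p hp hpA
  refine (BoundedContinuousFunction.dist_le hε.le).2 fun x => ?_
  obtain ⟨i, hx⟩ := mem_iUnion.1 (hU.ge (mem_univ x))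
  have hi : (U i).Nonempty := ⟨x, hx⟩
  have h₁ := (abs_le.1 (hUB i x hx _ hi.some_mem _ (sub_mem_sub hpA.1 hpA.2))).2
  have h₂ := hp i hi
  rw [dist_eq_norm] at h₂ ⊢
  simp only [BoundedContinuousFunction.coe_sub, Pi.sub_apply] at h₁
  linarith

/-- **Compactness criterion in `C(X,E)`.**  Let `X` be a topological space and `E` a
normed space.  A non-empty subset `A` of the space of bounded continuous maps `X →ᵇ E`
(with the supremum norm) is precompact iff `A - A` satisfies condition (B) and every
section `A(x)` is precompact in `E`. -/
theorem stmt_6 {X E : Type*} [TopologicalSpace X]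
    [NormedAddCommGroup E] [NormedSpace ℝ E]
    (A : Set (BoundedContinuousFunction X E)) (hA : A.Nonempty) :
    TotallyBounded A ↔
      CondB (A - A) ∧
        ∀ x : X, TotallyBounded ((fun f : BoundedContinuousFunction X E => f x) '' A) := by
  refine ⟨fun h => ⟨(h.sub_set h).condB, fun x => h.image ?_⟩, fun h => h.1.totallyBounded h.2⟩
  exact (BoundedContinuousFunction.lipschitz_eval_const x).uniformContinuous
end

section
/- Let φ be a comparison function, (X, d) a metric space with a fixed base point x_*, n ∈ ℕ, and 𝕂 be ℝ or ℂ. A non-empty subset A of Lip_φ(X, 𝕂^n) is precompact (with respect to the norm ‖f‖_φ = ‖f(x_*)‖ + |f|_φ) if and only if A is bounded and satisfies the condition (LDS). -/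
open Pointwise Metric

/-- A comparison function. -/
structure IsCompFun (φ : ℝ → ℝ) : Prop where
  nonneg : ∀ t : ℝ, 0 ≤ t → 0 ≤ φ t
  map_zero : φ 0 = 0
  right_cont : ContinuousWithinAt φ (Set.Ici 0) 0
  concave : ConcaveOn ℝ (Set.Ici 0) φ
  ne_zero : ∃ t : ℝ, 0 ≤ t ∧ φ t ≠ 0

/-- The Lipschitz seminorm `|f|_φ`. -/
noncomputable def lipSemi {X E : Type*} [MetricSpace X] [NormedAddCommGroup E]
    (φ : ℝ → ℝ) (f : X → E) : ℝ :=
  sSup {r : ℝ | ∃ x y : X, x ≠ y ∧ r = ‖f x - f y‖ / φ (dist x y)}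

/-- Membership in `Lip_φ(X,E)`. -/
def MemLip {X E : Type*} [MetricSpace X] [NormedAddCommGroup E]
    (φ : ℝ → ℝ) (f : X → E) : Prop :=
  BddAbove {r : ℝ | ∃ x y : X, x ≠ y ∧ r = ‖f x - f y‖ / φ (dist x y)}

/-- The norm `‖f‖_φ = ‖f x₀‖ + |f|_φ`. -/
noncomputable def lipNorm {X E : Type*} [MetricSpace X] [NormedAddCommGroup E]
    (φ : ℝ → ℝ) (x₀ : X) (f : X → E) : ℝ :=
  ‖f x₀‖ + lipSemi φ f

/-- Precompactness of `A` with respect to the gauge `N`. -/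
def Precomp {α : Type*} [Sub α] (N : α → ℝ) (A : Set α) : Prop :=
  ∀ ε : ℝ, 0 < ε → ∃ T : Set α, T ⊆ A ∧ T.Finite ∧ ∀ f ∈ A, ∃ g ∈ T, N (f - g) ≤ ε

/-- Condition (LDS): for every `ε > 0` there is a finite cover `U_1, …, U_N` of
`X̃ = (X×X) \ Δ` such that the difference quotients `(f x - f y)/φ(d(x,y))` vary by at
most `ε` in norm on each `U_i`, uniformly in `f ∈ S`. -/
def CondLDS {X E : Type*} [MetricSpace X] [NormedAddCommGroup E] [NormedSpace ℝ E]
    (φ : ℝ → ℝ) (S : Set (X → E)) : Prop :=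
  ∀ ε : ℝ, 0 < ε → ∃ (N : ℕ) (U : Fin N → Set (X × X)),
    (∀ i, U i ⊆ {p : X × X | p.1 ≠ p.2}) ∧
    {p : X × X | p.1 ≠ p.2} ⊆ ⋃ i, U i ∧
    ∀ i : Fin N, ∀ p ∈ U i, ∀ q ∈ U i, ∀ f ∈ S,
      ‖(φ (dist p.1 p.2))⁻¹ • (f p.1 - f p.2) -
        (φ (dist q.1 q.2))⁻¹ • (f q.1 - f q.2)‖ ≤ ε

/-- A set with bounded image in a proper space has finite nets, as seen through the map. -/
lemma exists_finite_net_of_isBounded_image {ι V : Type*} [PseudoMetricSpace V] [ProperSpace V]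
    (F : ι → V) (S : Set ι) (hF : Bornology.IsBounded (F '' S)) {δ : ℝ} (hδ : 0 < δ) :
    ∃ T ⊆ S, T.Finite ∧ ∀ s ∈ S, ∃ t ∈ T, dist (F s) (F t) < δ := by
  have htb : TotallyBounded (F '' S) := hF.isCompact_closure.totallyBounded.subset subset_closure
  obtain ⟨t, htS, htf, hcov⟩ := Metric.finite_approx_of_totallyBounded htb δ hδ
  choose g hgS hg using fun v : t => htS v.2
  have := htf.to_subtype
  refine ⟨Set.range g, Set.range_subset_iff.2 hgS, Set.finite_range g, fun s hs => ?_⟩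
  obtain ⟨v, hv, hsv⟩ := Set.mem_iUnion₂.1 (hcov (Set.mem_image_of_mem F hs))
  exact ⟨g ⟨v, hv⟩, Set.mem_range_self _, by rw [hg ⟨v, hv⟩]; exact hsv⟩

section DiffQuot

variable {X E : Type*} [MetricSpace X] [NormedAddCommGroup E] {φ : ℝ → ℝ}

lemma lipSemi_nonneg (hφ : IsCompFun φ) (f : X → E) : 0 ≤ lipSemi φ f := by
  refine Real.sSup_nonneg ?_
  rintro _ ⟨x, y, -, rfl⟩
  exact div_nonneg (norm_nonneg _) (hφ.nonneg _ dist_nonneg)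

lemma norm_apply_le_lipNorm (hφ : IsCompFun φ) (x₀ : X) (f : X → E) :
    ‖f x₀‖ ≤ lipNorm φ x₀ f :=
  le_add_of_nonneg_right (lipSemi_nonneg hφ f)

variable [NormedSpace ℝ E]

/-- The difference quotient of `f` with respect to `φ`. -/
noncomputable def diffQuot (φ : ℝ → ℝ) (f : X → E) (p : X × X) : E :=
  (φ (dist p.1 p.2))⁻¹ • (f p.1 - f p.2)

lemma diffQuot_sub (f g : X → E) (p : X × X) :
    diffQuot φ (f - g) p = diffQuot φ f p - diffQuot φ g p := by
  simp only [diffQuot, Pi.sub_apply, ← smul_sub]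
  congr 1
  abel

lemma norm_diffQuot (hφ : IsCompFun φ) (f : X → E) (p : X × X) :
    ‖diffQuot φ f p‖ = ‖f p.1 - f p.2‖ / φ (dist p.1 p.2) := by
  rw [diffQuot, norm_smul, norm_inv, Real.norm_of_nonneg (hφ.nonneg _ dist_nonneg),
    div_eq_inv_mul]

lemma norm_diffQuot_le_lipSemi (hφ : IsCompFun φ) {f : X → E} (hf : MemLip φ f) {p : X × X}
    (hp : p.1 ≠ p.2) : ‖diffQuot φ f p‖ ≤ lipSemi φ f := by
  rw [norm_diffQuot hφ]
  exact le_csSup hf ⟨p.1, p.2, hp, rfl⟩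

lemma norm_diffQuot_le_lipNorm (hφ : IsCompFun φ) (x₀ : X) {f : X → E} (hf : MemLip φ f)
    {p : X × X} (hp : p.1 ≠ p.2) : ‖diffQuot φ f p‖ ≤ lipNorm φ x₀ f :=
  (norm_diffQuot_le_lipSemi hφ hf hp).trans (le_add_of_nonneg_left (norm_nonneg _))

lemma lipSemi_le (hφ : IsCompFun φ) {f : X → E} {c : ℝ} (hc : 0 ≤ c)
    (h : ∀ p : X × X, p.1 ≠ p.2 → ‖diffQuot φ f p‖ ≤ c) : lipSemi φ f ≤ c := by
  refine Real.sSup_le ?_ hc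
  rintro _ ⟨x, y, hxy, rfl⟩
  simpa only [norm_diffQuot hφ] using h (x, y) hxy

lemma MemLip.sub (hφ : IsCompFun φ) {f g : X → E} (hf : MemLip φ f) (hg : MemLip φ g) :
    MemLip φ (f - g) := by
  refine ⟨lipSemi φ f + lipSemi φ g, ?_⟩
  rintro _ ⟨x, y, hxy, rfl⟩
  rw [← norm_diffQuot hφ (f - g) (x, y), diffQuot_sub]
  exact (norm_sub_le _ _).trans (add_le_add
    (norm_diffQuot_le_lipSemi hφ hf (p := (x, y)) hxy)
    (norm_diffQuot_le_lipSemi hφ hg (p := (x, y)) hxy))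

lemma lipNorm_le_add_sub (hφ : IsCompFun φ) (x₀ : X) {f g : X → E} (hf : MemLip φ f)
    (hg : MemLip φ g) : lipNorm φ x₀ f ≤ lipNorm φ x₀ g + lipNorm φ x₀ (f - g) := by
  have h1 : ‖f x₀‖ ≤ ‖g x₀‖ + ‖(f - g) x₀‖ := norm_le_norm_add_norm_sub' _ _
  have h2 : lipSemi φ f ≤ lipSemi φ g + lipSemi φ (f - g) := by
    refine lipSemi_le hφ (add_nonneg (lipSemi_nonneg hφ _) (lipSemi_nonneg hφ _)) fun p hp => ?_
    have h := norm_diffQuot_le_lipSemi hφ (hf.sub hφ hg) hp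
    rw [diffQuot_sub] at h
    exact (norm_le_norm_add_norm_sub' _ _).trans
      (add_le_add (norm_diffQuot_le_lipSemi hφ hg hp) h)
  unfold lipNorm
  linarith

variable {A : Set (X → E)}

lemma Precomp.exists_lipNorm_le (hφ : IsCompFun φ) {x₀ : X} (hAL : ∀ f ∈ A, MemLip φ f)
    (h : Precomp (lipNorm φ x₀) A) : ∃ M : ℝ, ∀ f ∈ A, lipNorm φ x₀ f ≤ M := by
  obtain ⟨T, hTA, hTf, hT⟩ := h 1 one_pos
  obtain ⟨M, hM⟩ := (hTf.image (lipNorm φ x₀)).bddAbove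
  refine ⟨M + 1, fun f hf => ?_⟩
  obtain ⟨g, hg, hfg⟩ := hT f hf
  exact (lipNorm_le_add_sub hφ x₀ (hAL f hf) (hAL g (hTA hg))).trans
    (add_le_add (hM (Set.mem_image_of_mem _ hg)) hfg)

lemma Precomp.condLDS [ProperSpace E] (hφ : IsCompFun φ) {x₀ : X} (hAL : ∀ f ∈ A, MemLip φ f)
    (h : Precomp (lipNorm φ x₀) A) : CondLDS φ A := by
  intro ε hε
  obtain ⟨T, hTA, hTf, hT⟩ := h (ε / 4) (by positivity)
  have : Fintype T := hTf.fintype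
  let F : X × X → T → E := fun p g => diffQuot φ g.1 p
  have hb : Bornology.IsBounded (F '' {p : X × X | p.1 ≠ p.2}) := by
    refine Bornology.forall_isBounded_image_eval_iff.1 fun g => ?_
    refine isBounded_iff_forall_norm_le.2 ⟨lipSemi φ g.1, ?_⟩
    rintro _ ⟨_, ⟨p, hp, rfl⟩, rfl⟩
    exact norm_diffQuot_le_lipSemi hφ (hAL _ (hTA g.2)) hp
  obtain ⟨P, -, hPf, hP⟩ := exists_finite_net_of_isBounded_image F _ hb
    (show 0 < ε / 4 by positivity)
  obtain ⟨N, c, -, rfl⟩ := hPf.fin_param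
  refine ⟨N, fun i => {p | p.1 ≠ p.2 ∧ dist (F p) (F (c i)) < ε / 4}, fun i p hp => hp.1,
    fun p hp => ?_, fun i p hp q hq f hf => ?_⟩
  · obtain ⟨_, ⟨i, rfl⟩, hi⟩ := hP p hp
    exact Set.mem_iUnion.2 ⟨i, hp, hi⟩
  · obtain ⟨g, hg, hfg⟩ := hT f hf
    have hclose : ∀ r : X × X, r.1 ≠ r.2 → dist (diffQuot φ f r) (diffQuot φ g r) ≤ ε / 4 := by
      intro r hr
      rw [dist_eq_norm, ← diffQuot_sub]
      exact (norm_diffQuot_le_lipNorm hφ x₀ ((hAL f hf).sub hφ (hAL g (hTA hg))) hr).trans hfg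
    have hnet : ∀ r : X × X, dist (F r) (F (c i)) < ε / 4 →
        dist (diffQuot φ g r) (diffQuot φ g (c i)) ≤ ε / 4 :=
      fun r hr => (dist_le_pi_dist (F r) (F (c i)) ⟨g, hg⟩).trans hr.le
    have h1 := hclose p hp.1
    have h2 := hclose q hq.1
    have h3 := hnet p hp.2
    have h4 := hnet q hq.2
    change ‖diffQuot φ f p - diffQuot φ f q‖ ≤ ε
    rw [← dist_eq_norm]
    have t1 := dist_triangle4 (diffQuot φ f p) (diffQuot φ g p) (diffQuot φ g q) (diffQuot φ f q)
    have t2 := dist_triangle_right (diffQuot φ g p) (diffQuot φ g q) (diffQuot φ g (c i))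
    rw [dist_comm (diffQuot φ g q) (diffQuot φ f q)] at t1
    linarith

lemma precomp_of_bounded_of_condLDS [ProperSpace E] (hφ : IsCompFun φ) {x₀ : X}
    (hAL : ∀ f ∈ A, MemLip φ f) {M : ℝ} (hM : ∀ f ∈ A, lipNorm φ x₀ f ≤ M)
    (h : CondLDS φ A) : Precomp (lipNorm φ x₀) A := by
  intro ε hε
  obtain ⟨N, U, hU, hcov, hvar⟩ := h (ε / 4) (by positivity)
  let I := {i : Fin N // (U i).Nonempty}
  have : Fintype I := Fintype.ofFinite I
  let c : I → X × X := fun i => i.2.some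
  have hc : ∀ i : I, c i ∈ U i.1 := fun i => i.2.some_mem
  let F : (X → E) → E × (I → E) := fun f => (f x₀, fun i => diffQuot φ f (c i))
  have hb : Bornology.IsBounded (F '' A) := by
    refine isBounded_iff_forall_norm_le.2 ⟨max M 0, ?_⟩
    rintro _ ⟨f, hf, rfl⟩
    refine norm_prod_le_iff.2 ⟨?_, (pi_norm_le_iff_of_nonneg (le_max_right _ _)).2 fun i => ?_⟩
    · exact ((norm_apply_le_lipNorm hφ x₀ f).trans (hM f hf)).trans (le_max_left _ _)
    · exact ((norm_diffQuot_le_lipNorm hφ x₀ (hAL f hf) (hU i.1 (hc i))).trans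
        (hM f hf)).trans (le_max_left _ _)
  obtain ⟨T, hTA, hTf, hT⟩ := exists_finite_net_of_isBounded_image F A hb
    (show 0 < ε / 4 by positivity)
  refine ⟨T, hTA, hTf, fun f hf => ?_⟩
  obtain ⟨g, hg, hfg⟩ := hT f hf
  rw [Prod.dist_eq] at hfg
  have hx₀ : ‖(f - g) x₀‖ ≤ ε / 4 := by
    rw [Pi.sub_apply, ← dist_eq_norm]
    exact (le_max_left _ _).trans hfg.le
  have hsemi : lipSemi φ (f - g) ≤ 3 * (ε / 4) := by
    refine lipSemi_le hφ (by positivity) fun p hp => ?_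
    obtain ⟨i, hi⟩ := Set.mem_iUnion.1 (hcov hp)
    let j : I := ⟨i, p, hi⟩
    have h1 : ‖diffQuot φ f p - diffQuot φ f (c j)‖ ≤ ε / 4 := hvar i p hi (c j) (hc j) f hf
    have h2 : ‖diffQuot φ g p - diffQuot φ g (c j)‖ ≤ ε / 4 :=
      hvar i p hi (c j) (hc j) g (hTA hg)
    have h3 : dist (diffQuot φ f (c j)) (diffQuot φ g (c j)) ≤ ε / 4 :=
      (dist_le_pi_dist (F f).2 (F g).2 j).trans ((le_max_right _ _).trans hfg.le)
    rw [← dist_eq_norm] at h1 h2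
    rw [diffQuot_sub, ← dist_eq_norm]
    have t := dist_triangle4 (diffQuot φ f p) (diffQuot φ f (c j)) (diffQuot φ g (c j))
      (diffQuot φ g p)
    rw [dist_comm (diffQuot φ g (c j)) (diffQuot φ g p)] at t
    linarith
  refine ⟨g, hg, ?_⟩
  calc ‖(f - g) x₀‖ + lipSemi φ (f - g) ≤ ε / 4 + 3 * (ε / 4) := add_le_add hx₀ hsemi
    _ = ε := by ring

end DiffQuot

/-- **Compactness criterion in `Lip_φ(X,𝕂ⁿ)`** for `𝕂 = ℝ` or `ℂ`. -/
theorem stmt_12 (n : ℕ) (𝕂 : Type*) [RCLike 𝕂] {X : Type*} [MetricSpace X]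
    (φ : ℝ → ℝ) (hφ : IsCompFun φ) (x₀ : X)
    (A : Set (X → EuclideanSpace 𝕂 (Fin n))) (hA : A.Nonempty)
    (hAL : ∀ f ∈ A, MemLip φ f) :
    Precomp (lipNorm φ x₀) A ↔
      (∃ M : ℝ, ∀ f ∈ A, lipNorm φ x₀ f ≤ M) ∧ CondLDS φ A := by
  have : ProperSpace (EuclideanSpace 𝕂 (Fin n)) := FiniteDimensional.proper_rclike 𝕂 _
  exact ⟨fun h => ⟨h.exists_lipNorm_le hφ hAL, h.condLDS hφ hAL⟩,
    fun ⟨⟨_, hM⟩, h⟩ => precomp_of_bounded_of_condLDS hφ hAL hM h⟩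
end
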